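/- Let j ∈ [n] and i ∈ [j−1]. Then in k[S_n] we have [t_i, t_j] = (i ⟹ j−1) · [t_{j−1}, t_j] = μ_{i,j} · (t_j − t_{j−1} + 1). -/

import Mathlib

/-- The simple transposition `s_i ∈ S_n` (1-based indexing), swapping `i` and `i+1`,
defined as the identity for `i` outside `{1, …, n-1}`. -/
def simpleTransposition (n i : ℕ) : Equiv.Perm (Fin n) :=
  if h : 1 ≤ i ∧ i < n then
    Equiv.swap ⟨i - 1, by omega⟩ ⟨i, h.2⟩
  else 1

/-- The cycle `(v ⟹ w) = s_v s_{v+1} ⋯ s_{w-1} ∈ S_n`, sending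
`v ↦ v+1 ↦ ⋯ ↦ w ↦ v` (and equal to the identity when `v = w`). -/
def cyc (n v w : ℕ) : Equiv.Perm (Fin n) :=
  ((List.range' v (w - v)).map (simpleTransposition n)).prod

/-- The somewhere-to-below shuffle `t_ℓ = Σ_{w=ℓ}^{n} (ℓ ⟹ w)` in the group
algebra `R[S_n]`. -/
noncomputable def t (R : Type*) [CommRing R] (n ℓ : ℕ) :
    MonoidAlgebra R (Equiv.Perm (Fin n)) :=
  ∑ w ∈ Finset.Icc ℓ n, MonoidAlgebra.of R (Equiv.Perm (Fin n)) (cyc n ℓ w)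

/-- The element `μ_{i,j} = (i ⟹ j-1) · t_{j-1}` of the group algebra `R[S_n]`. -/
noncomputable def mu (R : Type*) [CommRing R] (n i j : ℕ) :
    MonoidAlgebra R (Equiv.Perm (Fin n)) :=
  MonoidAlgebra.of R (Equiv.Perm (Fin n)) (cyc n i (j - 1)) * t R n (j - 1)

theorem simpleTransposition_commute (n : ℕ) {a b : ℕ} (h : a + 1 < b) :
    Commute (simpleTransposition n a) (simpleTransposition n b) := by
  unfold simpleTransposition
  split_ifs with h1 h2
  · apply Equiv.Perm.Disjoint.commute
    intro x
    by_cases hx : x.val = a - 1 ∨ x.val = a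
    · right
      apply Equiv.swap_apply_of_ne_of_ne <;> simp only [ne_eq, Fin.ext_iff] <;> omega
    · left
      apply Equiv.swap_apply_of_ne_of_ne <;> simp only [ne_eq, Fin.ext_iff] <;> omega
  all_goals simp

theorem simpleTransposition_mul_self (n a : ℕ) :
    simpleTransposition n a * simpleTransposition n a = 1 := by
  unfold simpleTransposition
  split_ifs <;> simp

theorem simpleTransposition_braid {n a : ℕ} (ha : 1 ≤ a) (han : a + 1 < n) :
    simpleTransposition n a * simpleTransposition n (a + 1) * simpleTransposition n a =
      simpleTransposition n (a + 1) * simpleTransposition n a * simpleTransposition n (a + 1) := by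
  have h1 : 1 ≤ a ∧ a < n := ⟨ha, by omega⟩
  have h2 : 1 ≤ a + 1 ∧ a + 1 < n := ⟨by omega, han⟩
  simp only [simpleTransposition, dif_pos h1, dif_pos h2, Nat.add_sub_cancel]
  rw [Equiv.swap_comm (⟨a - 1, _⟩ : Fin n),
    Equiv.swap_comm (⟨a, _⟩ : Fin n) ⟨a + 1, _⟩, Equiv.swap_mul_swap_mul_swap,
    Equiv.swap_comm (⟨a, _⟩ : Fin n) ⟨a - 1, _⟩, Equiv.swap_comm (⟨a + 1, _⟩ : Fin n) ⟨a, _⟩,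
    Equiv.swap_mul_swap_mul_swap, Equiv.swap_comm]
  all_goals simp only [ne_eq, Fin.ext_iff]; omega

theorem cyc_self (n v : ℕ) : cyc n v v = 1 := by simp [cyc]

theorem cyc_succ (n v : ℕ) : cyc n v (v + 1) = simpleTransposition n v := by simp [cyc]

theorem cyc_mul_cyc (n : ℕ) {u v w : ℕ} (huv : u ≤ v) (hvw : v ≤ w) :
    cyc n u v * cyc n v w = cyc n u w := by
  obtain ⟨p, rfl⟩ := Nat.exists_eq_add_of_le huv
  obtain ⟨q, rfl⟩ := Nat.exists_eq_add_of_le hvw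
  simp only [cyc, ← List.prod_append, ← List.map_append]
  rw [show u + p - u = p by omega, show u + p + q - (u + p) = q by omega,
    show u + p + q - u = p + q by omega, ← List.range'_append_1]

theorem cyc_commute_of_forall {n v w : ℕ} {g : Equiv.Perm (Fin n)}
    (h : ∀ k, v ≤ k → k < w → Commute (simpleTransposition n k) g) :
    Commute (cyc n v w) g := by
  apply Commute.list_prod_left
  simp only [List.mem_map, List.mem_range'_1]
  rintro _ ⟨k, hk, rfl⟩
  exact h k hk.1 (by omega)

theorem cyc_commute_cyc (n : ℕ) {u v x y : ℕ} (h : v < x) :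
    Commute (cyc n u v) (cyc n x y) :=
  cyc_commute_of_forall fun _ _ hk => (cyc_commute_of_forall fun _ hl _ =>
    (simpleTransposition_commute n (by omega)).symm).symm

theorem cyc_mul_simpleTransposition {n v w k : ℕ} (hv : 1 ≤ v) (hk : v ≤ k) (hkw : k + 1 < w)
    (hw : w ≤ n) :
    cyc n v w * simpleTransposition n k = simpleTransposition n (k + 1) * cyc n v w := by
  have hc1 : Commute (cyc n v k) (simpleTransposition n (k + 1)) := by
    rw [← cyc_succ]; exact cyc_commute_cyc n (by omega)
  have hc2 : Commute (simpleTransposition n k) (cyc n (k + 2) w) := by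
    rw [← cyc_succ]; exact cyc_commute_cyc n (by omega)
  have hb := simpleTransposition_braid (n := n) (hv.trans hk) (by omega)
  rw [← cyc_mul_cyc n hk (by omega : k ≤ w), ← cyc_mul_cyc n k.le_succ (by omega : k + 1 ≤ w),
    ← cyc_mul_cyc n (k + 1).le_succ (by omega : k + 2 ≤ w), cyc_succ, cyc_succ]
  calc
    _ = cyc n v k * (simpleTransposition n k * simpleTransposition n (k + 1)) *
        (cyc n (k + 2) w * simpleTransposition n k) := by simp only [mul_assoc]
    _ = cyc n v k * (simpleTransposition n k * simpleTransposition n (k + 1) *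
        simpleTransposition n k) * cyc n (k + 2) w := by rw [← hc2.eq]; simp only [mul_assoc]
    _ = (cyc n v k * simpleTransposition n (k + 1)) * (simpleTransposition n k *
        simpleTransposition n (k + 1)) * cyc n (k + 2) w := by rw [hb]; simp only [mul_assoc]
    _ = _ := by rw [hc1.eq]; simp only [mul_assoc]

theorem cyc_mul_cyc_of_lt {n v u w : ℕ} (hv : 1 ≤ v) (hu : v ≤ u) (huw : u < w) (hw : w ≤ n) :
    cyc n v w * cyc n v u = cyc n (v + 1) (u + 1) * cyc n v w := by
  induction u, hu using Nat.le_induction with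
  | base => simp [cyc_self]
  | succ u hu ih =>
    rw [← cyc_mul_cyc n hu u.le_succ, ← mul_assoc, ih (by omega), mul_assoc, cyc_succ,
      cyc_mul_simpleTransposition hv hu huw hw, ← mul_assoc,
      ← cyc_mul_cyc n (by omega : v + 1 ≤ u + 1) (u + 1).le_succ, cyc_succ]

section GroupAlgebra

open Finset MonoidAlgebra

variable (R : Type*) [CommRing R]

theorem of_cyc_commute_t (n : ℕ) {u v x : ℕ} (h : v < x) :
    Commute (of R (Equiv.Perm (Fin n)) (cyc n u v)) (t R n x) :=
  Commute.sum_right _ _ _ fun _ _ => (cyc_commute_cyc n h).map _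

theorem t_eq_sum_add_mul_t (n : ℕ) {i m : ℕ} (him : i ≤ m) (hm : m ≤ n) :
    t R n i = ∑ w ∈ Ico i m, of R (Equiv.Perm (Fin n)) (cyc n i w) +
      of R (Equiv.Perm (Fin n)) (cyc n i m) * t R n m := by
  have h : Icc i n = Ico i m ∪ Icc m n := by ext; simp only [mem_union, mem_Icc, mem_Ico]; omega
  rw [t, h, sum_union (by
    rw [disjoint_left]; simp only [mem_Icc, mem_Ico]; omega), t, mul_sum]
  congr 1
  refine sum_congr rfl fun w hw => ?_
  rw [← map_mul, cyc_mul_cyc n him (mem_Icc.1 hw).1]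

theorem t_eq_one_add {n l : ℕ} (hl : l < n) :
    t R n l = 1 + of R (Equiv.Perm (Fin n)) (simpleTransposition n l) * t R n (l + 1) := by
  rw [t_eq_sum_add_mul_t R n l.le_succ hl, Nat.succ_eq_add_one, cyc_succ]
  simp [cyc_self, one_def]

theorem simpleTransposition_mul_t_mul_t (n : ℕ) {l : ℕ} (hl : 1 ≤ l) :
    of R (Equiv.Perm (Fin n)) (simpleTransposition n l) * (t R n (l + 1) * t R n l) =
      t R n (l + 1) * t R n l := by
  set s := of R (Equiv.Perm (Fin n)) (simpleTransposition n l)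
  let f : ℕ × ℕ → MonoidAlgebra R (Equiv.Perm (Fin n)) := fun p =>
    of R _ (cyc n (l + 1) p.1 * cyc n l p.2)
  let I := Icc (l + 1) n ×ˢ Icc l n
  have hs : s * s = 1 := by
    simp only [s, ← map_mul, simpleTransposition_mul_self, map_one]
  have hsum : t R n (l + 1) * t R n l = ∑ p ∈ I, f p := by
    simp only [t, sum_mul_sum, I, sum_product, f, map_mul]
  have hB : ∑ p ∈ I with ¬ p.2 < p.1, f p = s * ∑ p ∈ I with p.2 < p.1, f p := by
    rw [mul_sum]
    symm
    refine sum_bij' (fun p _ => (p.2 + 1, p.1)) (fun p _ => (p.2, p.1 - 1)) ?_ ?_ ?_ ?_ ?_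
    · simp only [I, mem_filter, mem_product, mem_Icc]; omega
    · simp only [I, mem_filter, mem_product, mem_Icc]; omega
    · simp
    · rintro ⟨a, b⟩ h
      simp only [I, mem_filter, mem_product, mem_Icc] at h
      simp only [Prod.mk.injEq, and_true]; omega
    · rintro ⟨w, u⟩ h
      simp only [I, mem_filter, mem_product, mem_Icc] at h
      simp only [s, f, ← map_mul]
      rw [← cyc_mul_cyc_of_lt hl (by omega) h.2 (by omega), ← cyc_succ, ← mul_assoc,
        cyc_mul_cyc n l.le_succ (by omega)]
  rw [hsum, ← sum_filter_add_sum_filter_not I (fun p => p.2 < p.1), hB, mul_add, ← mul_assoc, hs,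
    one_mul, add_comm]

theorem t_mul_t_sub_t_mul_t {n l : ℕ} (hl : 1 ≤ l) (hln : l < n) :
    t R n l * t R n (l + 1) - t R n (l + 1) * t R n l =
      t R n l * (t R n (l + 1) - t R n l + 1) := by
  have h : t R n (l + 1) * t R n l = t R n l * t R n l - t R n l := by
    rw [← simpleTransposition_mul_t_mul_t R n hl, ← mul_assoc,
      eq_sub_of_add_eq' (t_eq_one_add R hln).symm, sub_mul, one_mul]
  rw [h]
  noncomm_ring

end GroupAlgebra

theorem comm_ti_tj_eq_mu
    (R : Type*) [CommRing R] (n : ℕ) (hn : 0 < n)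
    (j : ℕ) (hj1 : 1 ≤ j) (hjn : j ≤ n)
    (i : ℕ) (hi1 : 1 ≤ i) (hij : i ≤ j - 1) :
    (t R n i * t R n j - t R n j * t R n i
      = MonoidAlgebra.of R (Equiv.Perm (Fin n)) (cyc n i (j - 1))
        * (t R n (j - 1) * t R n j - t R n j * t R n (j - 1))) ∧
    (t R n i * t R n j - t R n j * t R n i
      = mu R n i j * (t R n j - t R n (j - 1) + 1)) := by
  have h : t R n i * t R n j - t R n j * t R n i
      = MonoidAlgebra.of R (Equiv.Perm (Fin n)) (cyc n i (j - 1))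
        * (t R n (j - 1) * t R n j - t R n j * t R n (j - 1)) := by
    have h1 : Commute (∑ w ∈ Finset.Ico i (j - 1), MonoidAlgebra.of R (Equiv.Perm (Fin n))
        (cyc n i w)) (t R n j) :=
      Commute.sum_left _ _ _ fun w hw =>
        of_cyc_commute_t R n (by have := Finset.mem_Ico.1 hw; omega)
    have h2 : Commute (MonoidAlgebra.of R (Equiv.Perm (Fin n)) (cyc n i (j - 1))) (t R n j) :=
      of_cyc_commute_t R n (by omega)
    rw [t_eq_sum_add_mul_t R n hij (by omega), add_mul, mul_add, h1.eq, add_sub_add_left_eq_sub,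
      mul_sub, ← mul_assoc (t R n j), ← h2.eq, mul_assoc, mul_assoc]
  refine ⟨h, ?_⟩
  obtain ⟨l, rfl⟩ : ∃ l, j = l + 1 := ⟨j - 1, by omega⟩
  simp only [Nat.add_sub_cancel] at h hij
  rw [h, mu, Nat.add_sub_cancel, mul_assoc, t_mul_t_sub_t_mul_t R (hi1.trans hij) hjn]
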